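/- Consider the (VS-SQN) scheme under the stated assumptions with stepsize γ_k = 1/(L·λ̄) for all k, with (N_k) an increasing sequence of positive integers, and with N_0 > 2ν₁²λ̄/(τ²λ̲). Then for every k ≥ 0, E[f(x_{k+1}) − f(x*)] ≤ (1 − τλ̲/(Lλ̄) + 2ν₁²/(L τ N_0))·E[f(x_k) − f(x*)] + (2ν₁²‖x*‖² + ν₂²)/(2 L N_k). -/

import Mathlib

open MeasureTheory Filter
open scoped RealInnerProductSpace Topology

noncomputable section

theorem StrongConvexOn.add_inner_add_le {E : Type*} [NormedAddCommGroup E] [InnerProductSpace ℝ E]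
    [CompleteSpace E] {f : E → ℝ} {τ : ℝ} {x g : E}
    (hf : StrongConvexOn Set.univ τ f) (hg : HasGradientAt f g x) (y : E) :
    f x + ⟪g, y - x⟫ + τ / 2 * ‖y - x‖ ^ 2 ≤ f y := by
  have hd : HasDerivAt (fun t : ℝ => f (x + t • (y - x))) ⟪g, y - x⟫ 0 := by
    have h0 : HasFDerivAt f (InnerProductSpace.toDual ℝ E g) (x + (0 : ℝ) • (y - x)) := by
      simpa using hg.hasFDerivAt
    have h1 : HasDerivAt (fun t : ℝ => x + t • (y - x)) (y - x) 0 := by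
      simpa using ((hasDerivAt_id (0 : ℝ)).smul_const (y - x)).const_add x
    simpa using! h0.comp_hasDerivAt (0 : ℝ) h1
  have hs := (hasDerivAt_iff_tendsto_slope.1 hd).mono_left
    (nhdsWithin_mono (0 : ℝ) (fun t (ht : 0 < t) => ht.ne') : 𝓝[>] (0 : ℝ) ≤ 𝓝[≠] 0)
  have hr : Tendsto (fun t : ℝ => f y - f x - (1 - t) * (τ / 2 * ‖y - x‖ ^ 2)) (𝓝[>] 0)
      (𝓝 (f y - f x - (1 - 0) * (τ / 2 * ‖y - x‖ ^ 2))) :=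
    Tendsto.mono_left (Continuous.tendsto (by fun_prop) 0) nhdsWithin_le_nhds
  have key := le_of_tendsto_of_tendsto hs hr <| by
    filter_upwards [Ioo_mem_nhdsGT (zero_lt_one' ℝ)] with t ht
    have h := hf.2 (Set.mem_univ x) (Set.mem_univ y) (sub_nonneg.2 ht.2.le) ht.1.le
      (sub_add_cancel 1 t)
    have he : (1 - t) • x + t • y = x + t • (y - x) := by module
    rw [he, norm_sub_rev] at h
    simp only [smul_eq_mul] at h
    rw [slope_def_field, div_le_iff₀ (by linarith [ht.1])]
    simp only [zero_smul, add_zero]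
    linarith
  linarith

theorem le_add_inner_add_of_gradient_lipschitz {E : Type*} [NormedAddCommGroup E]
    [InnerProductSpace ℝ E] [CompleteSpace E] {f : E → ℝ} {gf : E → E} {L : ℝ}
    (hg : ∀ z, HasGradientAt f (gf z) z) (hL : ∀ z z', ‖gf z - gf z'‖ ≤ L * ‖z - z'‖) (x y : E) :
    f y ≤ f x + ⟪gf x, y - x⟫ + L / 2 * ‖y - x‖ ^ 2 := by
  set d := y - x with hd_def
  have hd (t : ℝ) : HasDerivAt (fun t : ℝ => L / 2 * ‖d‖ ^ 2 * t ^ 2 + t * ⟪gf x, d⟫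
      - f (x + t • d)) (L * ‖d‖ ^ 2 * t + ⟪gf x, d⟫ - ⟪gf (x + t • d), d⟫) t := by
    have h1 : HasDerivAt (fun t : ℝ => x + t • d) d t := by
      simpa using ((hasDerivAt_id t).smul_const d).const_add x
    have h2 : HasDerivAt (fun t : ℝ => f (x + t • d)) ⟪gf (x + t • d), d⟫ t := by
      simpa using! (hg (x + t • d)).hasFDerivAt.comp_hasDerivAt t h1
    have h3 := ((hasDerivAt_pow 2 t).const_mul (L / 2 * ‖d‖ ^ 2)).add
      ((hasDerivAt_id t).mul_const ⟪gf x, d⟫)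
    convert! h3.sub h2 using 1
    simp only [Nat.cast_ofNat, Nat.add_one_sub_one, pow_one, one_mul]
    ring
  have hm := monotoneOn_of_deriv_nonneg (convex_Ici (0 : ℝ))
    (fun t _ => (hd t).continuousAt.continuousWithinAt)
    (fun t _ => (hd t).differentiableAt.differentiableWithinAt) (fun t ht => by
      rw [interior_Ici] at ht
      rw [(hd t).deriv]
      have h1 : ⟪gf (x + t • d) - gf x, d⟫ ≤ L * ‖d‖ ^ 2 * t := by
        refine (real_inner_le_norm _ _).trans ?_
        have h2 := hL (x + t • d) x
        rw [add_sub_cancel_left, norm_smul, Real.norm_of_nonneg (le_of_lt ht)] at h2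
        nlinarith [norm_nonneg d]
      rw [inner_sub_left] at h1
      linarith)
  have h := hm Set.self_mem_Ici (Set.mem_Ici.2 zero_le_one) zero_le_one
  have he : x + d = y := by simp [hd_def]
  simp only [zero_smul, one_smul, add_zero, he] at h
  linarith

theorem HasGradientAt.eq_zero_of_forall_le {E : Type*} [NormedAddCommGroup E]
    [InnerProductSpace ℝ E] [CompleteSpace E] {f : E → ℝ} {x g : E}
    (hg : HasGradientAt f g x) (hmin : ∀ z, f x ≤ f z) : g = 0 := by
  have h := IsLocalMin.hasFDerivAt_eq_zero (Eventually.of_forall hmin) hg.hasFDerivAt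
  simpa using h

/-- The Polyak–Łojasiewicz inequality. -/
theorem StrongConvexOn.two_mul_sub_le_norm_gradient_sq {E : Type*} [NormedAddCommGroup E]
    [InnerProductSpace ℝ E] [CompleteSpace E] {f : E → ℝ} {τ : ℝ} {x g : E} (hτ : 0 < τ)
    (hf : StrongConvexOn Set.univ τ f) (hg : HasGradientAt f g x) (y : E) :
    2 * τ * (f x - f y) ≤ ‖g‖ ^ 2 := by
  have h := hf.add_inner_add_le hg y
  have h1 := norm_add_sq_real g (τ • (y - x))
  rw [real_inner_smul_right, norm_smul, Real.norm_of_nonneg hτ.le] at h1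
  nlinarith [sq_nonneg ‖g + τ • (y - x)‖]

theorem LinearMap.IsSymmetric.norm_sq_le_mul_inner {E : Type*} [NormedAddCommGroup E]
    [InnerProductSpace ℝ E] {T : E →ₗ[ℝ] E} (hT : T.IsSymmetric) {c : ℝ} (hc : 0 < c)
    (h0 : ∀ v, 0 ≤ ⟪T v, v⟫) (hle : ∀ v, ⟪T v, v⟫ ≤ c * ‖v‖ ^ 2) (v : E) :
    ‖T v‖ ^ 2 ≤ c * ⟪T v, v⟫ := by
  have h := h0 (c • v - T v)
  have h1 := hle (T v)
  have h2 : ⟪T (T v), v⟫ = ‖T v‖ ^ 2 := by rw [hT, real_inner_self_eq_norm_sq]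
  simp only [map_sub, map_smul, inner_sub_left, inner_sub_right, real_inner_smul_left,
    real_inner_smul_right, h2, real_inner_self_eq_norm_sq] at h
  have h3 : 0 ≤ c * (c * ⟪T v, v⟫ - ‖T v‖ ^ 2) := by linarith
  linarith [nonneg_of_mul_nonneg_right h3 hc]

theorem LinearMap.norm_le_of_norm_sq_le_mul_inner {E : Type*} [NormedAddCommGroup E]
    [InnerProductSpace ℝ E] {T : E →ₗ[ℝ] E} {c : ℝ}
    (h : ∀ v, ‖T v‖ ^ 2 ≤ c * ⟪T v, v⟫) (hc : 0 ≤ c) (v : E) : ‖T v‖ ≤ c * ‖v‖ := by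
  have h1 := mul_le_mul_of_nonneg_left (real_inner_le_norm (T v) v) hc
  rcases (norm_nonneg (T v)).eq_or_lt with h0 | h0
  · rw [← h0]; positivity
  · exact le_of_mul_le_mul_left (by nlinarith [h v]) h0

theorem LinearMap.mul_norm_le_of_mul_norm_sq_le_inner {E : Type*} [NormedAddCommGroup E]
    [InnerProductSpace ℝ E] {T : E →ₗ[ℝ] E} {c : ℝ}
    (h : ∀ v, c * ‖v‖ ^ 2 ≤ ⟪T v, v⟫) (v : E) : c * ‖v‖ ≤ ‖T v‖ := by
  have h1 := real_inner_le_norm (T v) v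
  rcases (norm_nonneg v).eq_or_lt with h0 | h0
  · rw [← h0]; simp
  · exact le_of_mul_le_mul_right (by nlinarith [h v]) h0

theorem Measurable.toEuclideanLin_apply {Ω : Type*} {m : MeasurableSpace Ω} {n : ℕ}
    {A : Ω → Matrix (Fin n) (Fin n) ℝ} {v : Ω → EuclideanSpace ℝ (Fin n)}
    (hA : ∀ i j, Measurable fun ω => A ω i j) (hv : Measurable v) :
    Measurable fun ω => Matrix.toEuclideanLin (A ω) (v ω) := by
  have hv' (j : Fin n) : Measurable fun ω => v ω j :=
    (EuclideanSpace.proj (𝕜 := ℝ) j).continuous.measurable.comp hv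
  exact (MeasurableEquiv.toLp 2 (Fin n → ℝ)).measurable.comp <| measurable_pi_lambda
    (fun ω i => ∑ j, A ω i j * v ω j) fun i =>
      Finset.measurable_sum _ fun j _ => (hA i j).mul (hv' j)

theorem Measurable.matrix_inv_apply {Ω : Type*} {m : MeasurableSpace Ω} {n : ℕ}
    {A : Ω → Matrix (Fin n) (Fin n) ℝ} (hA : ∀ i j, Measurable fun ω => A ω i j) (i j : Fin n) :
    Measurable fun ω => (A ω)⁻¹ i j := by
  have hA' : Measurable (fun ω i j => A ω i j) :=
    measurable_pi_lambda _ fun i => measurable_pi_lambda _ fun j => hA i j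
  have hdet : Continuous fun B : Fin n → Fin n → ℝ => (Matrix.of B).det :=
    Continuous.matrix_det continuous_id
  have hadj : Continuous fun B : Fin n → Fin n → ℝ => (Matrix.of B).adjugate i j :=
    (Continuous.matrix_adjugate continuous_id).matrix_elem i j
  have h := ((hdet.measurable.comp hA').inv).mul (hadj.measurable.comp hA')
  simp only [Matrix.inv_def, Ring.inverse_eq_inv', Matrix.smul_apply, smul_eq_mul]
  exact h

theorem Matrix.toEuclideanLin_inv_apply_self {n : ℕ} {A : Matrix (Fin n) (Fin n) ℝ}
    (hA : Function.Injective (Matrix.toEuclideanLin A)) (v : EuclideanSpace ℝ (Fin n)) :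
    Matrix.toEuclideanLin A⁻¹ (Matrix.toEuclideanLin A v) = v := by
  have hu : IsUnit A := Matrix.mulVec_injective_iff_isUnit.1 fun a b hab => by
    have := @hA (WithLp.toLp 2 a) (WithLp.toLp 2 b) (by simp [Matrix.toLpLin_apply, hab])
    simpa using this
  have := (Matrix.isUnit_iff_isUnit_det A).1 hu
  simp [Matrix.toLpLin_apply, Matrix.nonsing_inv_mul A this]

/-- Pointwise one-step decrease of a preconditioned gradient step with additive noise `w`. -/
theorem StrongConvexOn.preconditioned_step_sub_le {E : Type*} [NormedAddCommGroup E]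
    [InnerProductSpace ℝ E] [CompleteSpace E] {f : E → ℝ} {gf : E → E} {τ L lam ulam : ℝ}
    (hτ : 0 < τ) (hL : 0 < L) (hlam : 0 < lam) (hulam : 0 < ulam)
    (hsc : StrongConvexOn Set.univ τ f) (hgrad : ∀ z, HasGradientAt f (gf z) z)
    (hlip : ∀ z z', ‖gf z - gf z'‖ ≤ L * ‖z - z'‖) {T : E →ₗ[ℝ] E} (hT : T.IsSymmetric)
    (hlow : ∀ v, lam * ‖v‖ ^ 2 ≤ ⟪T v, v⟫) (hup : ∀ v, ⟪T v, v⟫ ≤ ulam * ‖v‖ ^ 2)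
    (x w y : E) :
    f (x - (1 / (L * ulam)) • T (gf x + w)) - f y ≤
      (1 - τ * lam / (L * ulam)) * (f x - f y)
        + ⟪(1 / (L * ulam ^ 2)) • T (T (gf x)) - (1 / (L * ulam)) • T (gf x), w⟫
        + 1 / (2 * L) * ‖w‖ ^ 2 := by
  have hsq := hT.norm_sq_le_mul_inner hulam
    (fun v => (by positivity : 0 ≤ lam * ‖v‖ ^ 2).trans (hlow v)) hup
  have hTw := LinearMap.norm_le_of_norm_sq_le_mul_inner hsq hulam.le w
  have hTw2 : ‖T w‖ ^ 2 ≤ ulam ^ 2 * ‖w‖ ^ 2 := by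
    rw [← mul_pow]; gcongr
  have hd := le_add_inner_add_of_gradient_lipschitz hgrad hlip x
    (x - (1 / (L * ulam)) • T (gf x + w))
  have hpl := hsc.two_mul_sub_le_norm_gradient_sq hτ (hgrad x) y
  have hg := hsq (gf x)
  have hl := hlow (gf x)
  set g := gf x
  have h1 : ⟪g, T w⟫ = ⟪T g, w⟫ := (hT g w).symm
  have h2 : ⟪T (T g), w⟫ = ⟪T g, T w⟫ := hT _ _
  have h3 : ⟪g, T g⟫ = ⟪T g, g⟫ := real_inner_comm _ _
  rw [sub_sub_cancel_left, inner_neg_right, norm_neg, norm_smul, mul_pow, map_add,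
    norm_add_sq_real, real_inner_smul_right, inner_add_right, h1, h3, Real.norm_eq_abs,
    sq_abs] at hd
  rw [inner_sub_left, real_inner_smul_left, real_inner_smul_left, h2, map_add]
  set a := ⟪T g, g⟫
  set b := ⟪T g, w⟫
  set e := ⟪T g, T w⟫
  have e1 : L / 2 * ((1 / (L * ulam)) ^ 2 * (‖T g‖ ^ 2 + 2 * e + ‖T w‖ ^ 2)) ≤
      1 / (2 * L * ulam) * a + 1 / (L * ulam ^ 2) * e + 1 / (2 * L) * ‖w‖ ^ 2 := by
    calc _ ≤ L / 2 * ((1 / (L * ulam)) ^ 2 * (ulam * a + 2 * e + ulam ^ 2 * ‖w‖ ^ 2)) := by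
          gcongr
      _ = _ := by field_simp
  have e2 : 1 / (L * ulam) * (τ * lam * (f x - f y)) ≤ 1 / (L * ulam) * (a / 2) := by
    gcongr
    nlinarith
  have e3 : 1 / (L * ulam) * (a / 2) = 1 / (2 * L * ulam) * a := by field_simp
  have e4 : 1 / (L * ulam) * a = 2 * (1 / (2 * L * ulam) * a) := by field_simp
  have e5 : τ * lam / (L * ulam) * (f x - f y) = 1 / (L * ulam) * (τ * lam * (f x - f y)) := by
    ring
  linarith

theorem MeasureTheory.MemLp.integrable_real_inner {Ω E : Type*} {m0 : MeasurableSpace Ω}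
    {P : Measure Ω} [NormedAddCommGroup E] [InnerProductSpace ℝ E] {u w : Ω → E}
    (hu : MemLp u 2 P) (hw : MemLp w 2 P) : Integrable (fun ω => ⟪u ω, w ω⟫) P :=
  (hu.norm.integrable_mul hw.norm).mono' (hu.1.inner hw.1) <|
    .of_forall fun ω => norm_inner_le_norm (u ω) (w ω)

theorem integral_inner_eq_zero_of_condExp_eq_zero {Ω E : Type*} {m m0 : MeasurableSpace Ω}
    {P : Measure Ω} [IsFiniteMeasure P] [NormedAddCommGroup E] [InnerProductSpace ℝ E]
    [CompleteSpace E] (hm : m ≤ m0) {u w : Ω → E} (hu : StronglyMeasurable[m] u)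
    (hu2 : MemLp u 2 P) (hw2 : MemLp w 2 P) (hw : P[w | m] =ᵐ[P] 0) :
    ∫ ω, ⟪u ω, w ω⟫ ∂P = 0 := by
  have h := condExp_bilin_of_stronglyMeasurable_left (innerSL ℝ) hu
    (μ := P) (g := w) (hu2.integrable_real_inner hw2)
    (hw2.integrable one_le_two)
  have h2 : P[fun ω => ⟪u ω, w ω⟫ | m] =ᵐ[P] 0 := by
    refine EventuallyEq.trans h ?_
    filter_upwards [hw] with ω h
    simp [h]
  rw [← integral_condExp hm, integral_congr_ae h2]
  simp

/-- One-step expected decrease of the (VS-SQN) scheme for a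
`τ`-strongly convex `L`-smooth function. -/
theorem vs_sqn_convergence_in_mean
    {n : ℕ} {Ω : Type*} {m0 : MeasurableSpace Ω} (P : Measure Ω) [IsProbabilityMeasure P]
    (ℱ : Filtration ℕ m0)
    (f : EuclideanSpace ℝ (Fin n) → ℝ) (gf : EuclideanSpace ℝ (Fin n) → EuclideanSpace ℝ (Fin n))
    (τ L lam ulam ν₁ ν₂ : ℝ)
    (hτ : 0 < τ) (hL : 0 < L) (hlam : 0 < lam) (hlamle : lam ≤ ulam)
    (hν₁ : 0 < ν₁) (hν₂ : 0 < ν₂)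
    (hsc : StrongConvexOn Set.univ τ f)
    (hgrad : ∀ z, HasGradientAt f (gf z) z)
    (hlip : ∀ z z', ‖gf z - gf z'‖ ≤ L * ‖z - z'‖)
    (xstar : EuclideanSpace ℝ (Fin n)) (hmin : ∀ z, f xstar ≤ f z)
    (x w : ℕ → Ω → EuclideanSpace ℝ (Fin n))
    (H : ℕ → Ω → Matrix (Fin n) (Fin n) ℝ)
    (γ : ℕ → ℝ) (N : ℕ → ℕ)
    (hx_meas : ∀ k, Measurable[ℱ k] (x k))
    (hf_int : ∀ k, Integrable (fun ω => f (x k ω)) P)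
    (hH_meas : ∀ k, ∀ i j, Measurable[ℱ k] fun ω => H k ω i j)
    (hH_symm : ∀ k, ∀ᵐ ω ∂P, (H k ω).IsSymm)
    (hH_bnd : ∀ k, ∀ᵐ ω ∂P, ∀ v : EuclideanSpace ℝ (Fin n),
      lam * ‖v‖ ^ 2 ≤ ⟪(Matrix.toEuclideanLin (H k ω)) v, v⟫ ∧
      ⟪(Matrix.toEuclideanLin (H k ω)) v, v⟫ ≤ ulam * ‖v‖ ^ 2)
    (hw_mean : ∀ k, P[w k | ℱ k] =ᵐ[P] 0)
    (hw_var : ∀ k, ∀ᵐ ω ∂P,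
      (P[fun ω' => ‖w k ω'‖ ^ 2 | ℱ k]) ω ≤ (ν₁ ^ 2 * ‖x k ω‖ ^ 2 + ν₂ ^ 2) / (N k))
    (hupdate : ∀ k ω, x (k + 1) ω
      = x k ω - γ k • (Matrix.toEuclideanLin (H k ω)) (gf (x k ω) + w k ω))
    (hγ : ∀ k, γ k = 1 / (L * ulam))
    (hNpos : ∀ k, 0 < N k) (hNmono : Monotone N)
    (hN0 : 2 * ν₁ ^ 2 * ulam / (τ ^ 2 * lam) < (N 0 : ℝ)) :
    ∀ k, ∫ ω, (f (x (k + 1) ω) - f xstar) ∂P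
      ≤ (1 - τ * lam / (L * ulam) + 2 * ν₁ ^ 2 / (L * τ * N 0)) *
          ∫ ω, (f (x k ω) - f xstar) ∂P
        + (2 * ν₁ ^ 2 * ‖xstar‖ ^ 2 + ν₂ ^ 2) / (2 * L * N k) := by
  intro k
  have hulam : 0 < ulam := hlam.trans_le hlamle
  have hc : 0 < L * ulam := by positivity
  have hm : ℱ k ≤ m0 := ℱ.le k
  have hgs : gf xstar = 0 := (hgrad xstar).eq_zero_of_forall_le hmin
  have hdist (z) : ‖z - xstar‖ ^ 2 ≤ 2 / τ * (f z - f xstar) := by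
    have h := hsc.add_inner_add_le (hgrad xstar) z
    rw [hgs, inner_zero_left] at h
    rw [div_mul_eq_mul_div, le_div_iff₀ hτ]
    linarith
  have hgcont : Continuous gf :=
    (LipschitzWith.of_dist_le_mul (K := L.toNNReal) fun z z' => by
      simpa [dist_eq_norm, hL.le] using hlip z z').continuous
  have hint (j) : Integrable (fun ω => f (x j ω) - f xstar) P :=
    (hf_int j).sub (integrable_const _)
  have hXs (j) : MemLp (fun ω => x j ω - xstar) 2 P := by
    have hmeas : AEStronglyMeasurable (fun ω => x j ω - xstar) P :=
      (((hx_meas j).mono (ℱ.le j) le_rfl).sub_const xstar).aestronglyMeasurable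
    rw [memLp_two_iff_integrable_sq_norm hmeas]
    refine ((hint j).const_mul (2 / τ)).mono' (hmeas.norm.pow 2) (.of_forall fun ω => ?_)
    simpa using hdist (x j ω)
  have hX (j) : MemLp (x j) 2 P := by
    refine ((hXs j).add (memLp_const xstar)).ae_eq (.of_forall fun ω => ?_)
    simp
  have hG_meas : Measurable[ℱ k] fun ω => gf (x k ω) := hgcont.measurable.comp (hx_meas k)
  have hG : MemLp (fun ω => gf (x k ω)) 2 P :=
    (hXs k).of_le_mul (hG_meas.mono hm le_rfl).aestronglyMeasurable <| .of_forall fun ω => by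
      simpa [hgs] using hlip (x k ω) xstar
  set T : Ω → EuclideanSpace ℝ (Fin n) →ₗ[ℝ] EuclideanSpace ℝ (Fin n) :=
    fun ω => Matrix.toEuclideanLin (H k ω)
  have hT_symm : ∀ᵐ ω ∂P, (T ω).IsSymmetric := by
    filter_upwards [hH_symm k] with ω h
    refine Matrix.isSymmetric_toEuclideanLin_iff.2 ?_
    rwa [Matrix.IsHermitian, Matrix.conjTranspose_eq_transpose_of_trivial]
  have hT_norm : ∀ᵐ ω ∂P, ∀ v, ‖T ω v‖ ≤ ulam * ‖v‖ := by
    filter_upwards [hT_symm, hH_bnd k] with ω hs hb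
    exact LinearMap.norm_le_of_norm_sq_le_mul_inner (hs.norm_sq_le_mul_inner hulam
      (fun v => (by positivity : 0 ≤ lam * ‖v‖ ^ 2).trans (hb v).1) fun v => (hb v).2) hulam.le
  have hT_low : ∀ᵐ ω ∂P, ∀ v, lam * ‖v‖ ≤ ‖T ω v‖ := by
    filter_upwards [hH_bnd k] with ω hb
    exact LinearMap.mul_norm_le_of_mul_norm_sq_le_inner fun v => (hb v).1
  have hTG_meas : Measurable[ℱ k] fun ω => T ω (gf (x k ω)) :=
    Measurable.toEuclideanLin_apply (hH_meas k) hG_meas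
  have hTG : MemLp (fun ω => T ω (gf (x k ω))) 2 P :=
    hG.of_le_mul (hTG_meas.mono hm le_rfl).aestronglyMeasurable <| by
      filter_upwards [hT_norm] with ω h using h _
  have hTTG_meas : Measurable[ℱ k] fun ω => T ω (T ω (gf (x k ω))) :=
    Measurable.toEuclideanLin_apply (hH_meas k) hTG_meas
  have hTTG : MemLp (fun ω => T ω (T ω (gf (x k ω)))) 2 P :=
    hTG.of_le_mul (hTTG_meas.mono hm le_rfl).aestronglyMeasurable <| by
      filter_upwards [hT_norm] with ω h using h _
  have hstep (ω) : T ω (gf (x k ω) + w k ω) = (L * ulam) • (x k ω - x (k + 1) ω) := by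
    rw [hupdate k ω, hγ k, sub_sub_cancel, smul_smul, mul_one_div_cancel hc.ne', one_smul]
  have hU : MemLp (fun ω => T ω (gf (x k ω) + w k ω)) 2 P := by
    simp only [hstep]
    exact ((hX k).sub (hX (k + 1))).const_smul (L * ulam)
  -- The noise is a measurable function of consecutive iterates because `H k` is invertible.
  have hS_meas : AEStronglyMeasurable (fun ω => gf (x k ω) + w k ω) P := by
    have h : Measurable fun ω =>
        Matrix.toEuclideanLin (H k ω)⁻¹ ((L * ulam) • (x k ω - x (k + 1) ω)) :=
      Measurable.toEuclideanLin_apply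
        (Measurable.matrix_inv_apply fun i j => (hH_meas k i j).mono hm le_rfl)
        ((((hx_meas k).mono hm le_rfl).sub
          ((hx_meas (k + 1)).mono (ℱ.le _) le_rfl)).const_smul (L * ulam))
    refine h.aestronglyMeasurable.congr ?_
    filter_upwards [hT_low] with ω hl
    rw [← hstep ω]
    refine Matrix.toEuclideanLin_inv_apply_self ?_ _
    refine (injective_iff_map_eq_zero _).2 fun v hv => ?_
    have h := hl v
    simp only [T, hv, norm_zero] at h
    exact norm_le_zero_iff.1 (nonpos_of_mul_nonpos_right h hlam)
  have hS : MemLp (fun ω => gf (x k ω) + w k ω) 2 P :=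
    hU.of_le_mul (c := lam⁻¹) hS_meas <| by
      filter_upwards [hT_low] with ω hl
      rw [inv_mul_eq_div, le_div_iff₀' hlam]
      exact hl _
  have hW : MemLp (w k) 2 P := by
    refine (hS.sub hG).ae_eq (.of_forall fun ω => ?_)
    simp
  set C : Ω → EuclideanSpace ℝ (Fin n) := fun ω =>
    (1 / (L * ulam ^ 2)) • T ω (T ω (gf (x k ω))) - (1 / (L * ulam)) • T ω (gf (x k ω))
  have hC : MemLp C 2 P := by
    have h1 : MemLp (fun ω => (1 / (L * ulam ^ 2)) • T ω (T ω (gf (x k ω)))) 2 P :=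
      hTTG.const_smul (1 / (L * ulam ^ 2))
    have h2 : MemLp (fun ω => (1 / (L * ulam)) • T ω (gf (x k ω))) 2 P :=
      hTG.const_smul (1 / (L * ulam))
    exact h1.sub h2
  have hC_meas : StronglyMeasurable[ℱ k] C :=
    ((hTTG_meas.const_smul (1 / (L * ulam ^ 2))).sub
      (hTG_meas.const_smul (1 / (L * ulam)))).stronglyMeasurable
  have hcross : ∫ ω, ⟪C ω, w k ω⟫ ∂P = 0 :=
    integral_inner_eq_zero_of_condExp_eq_zero hm hC_meas hC hW (hw_mean k)
  have hCW : Integrable (fun ω => ⟪C ω, w k ω⟫) P := hC.integrable_real_inner hW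
  have hW2 : Integrable (fun ω => ‖w k ω‖ ^ 2) P := hW.integrable_norm_pow two_ne_zero
  have hX2 : Integrable (fun ω => ‖x k ω‖ ^ 2) P := (hX k).integrable_norm_pow two_ne_zero
  set D := ∫ ω, (f (x k ω) - f xstar) ∂P with hD
  have hD0 : 0 ≤ D := integral_nonneg fun ω => sub_nonneg.2 (hmin _)
  have hdecr : ∫ ω, (f (x (k + 1) ω) - f xstar) ∂P ≤
      (1 - τ * lam / (L * ulam)) * D + 1 / (2 * L) * ∫ ω, ‖w k ω‖ ^ 2 ∂P := by
    have h1 : Integrable (fun ω => (1 - τ * lam / (L * ulam)) * (f (x k ω) - f xstar)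
        + ⟪C ω, w k ω⟫) P := ((hint k).const_mul _).add hCW
    have h := integral_mono_ae (hint (k + 1)) (h1.add (hW2.const_mul (1 / (2 * L)))) <| by
      filter_upwards [hT_symm, hH_bnd k] with ω hs hb
      rw [hupdate k ω, hγ k]
      exact hsc.preconditioned_step_sub_le hτ hL hlam hulam hgrad hlip hs (fun v => (hb v).1)
        (fun v => (hb v).2) (x k ω) (w k ω) xstar
    rw [integral_add' h1 (hW2.const_mul _), integral_add ((hint k).const_mul _) hCW, hcross,
      integral_const_mul, integral_const_mul, add_zero] at h
    exact h
  have hnoise : ∫ ω, ‖w k ω‖ ^ 2 ∂P ≤ (ν₁ ^ 2 * ∫ ω, ‖x k ω‖ ^ 2 ∂P + ν₂ ^ 2) / N k := by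
    rw [← integral_condExp hm]
    refine (integral_mono_ae integrable_condExp
      (((hX2.const_mul (ν₁ ^ 2)).add (integrable_const (ν₂ ^ 2))).div_const (N k : ℝ))
      (hw_var k)).trans_eq ?_
    simp only [Pi.add_apply]
    rw [integral_div, integral_add (hX2.const_mul _) (integrable_const _), integral_const_mul]
    simp
  have hXD : ∫ ω, ‖x k ω‖ ^ 2 ∂P ≤ 4 / τ * D + 2 * ‖xstar‖ ^ 2 := by
    have h := integral_mono hX2
      (((hint k).const_mul (4 / τ)).add (integrable_const (2 * ‖xstar‖ ^ 2))) fun ω => by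
        have h1 := hdist (x k ω)
        have h2 : ‖x k ω‖ ≤ ‖x k ω - xstar‖ + ‖xstar‖ := by
          simpa using norm_add_le (x k ω - xstar) xstar
        have h3 : ‖x k ω‖ ^ 2 ≤ 2 * ‖x k ω - xstar‖ ^ 2 + 2 * ‖xstar‖ ^ 2 := by
          nlinarith [norm_nonneg (x k ω), sq_nonneg (‖x k ω - xstar‖ - ‖xstar‖)]
        have h4 : 4 / τ * (f (x k ω) - f xstar) = 2 * (2 / τ * (f (x k ω) - f xstar)) := by ring
        simp only [Pi.add_apply]
        linarith
    simp only [Pi.add_apply] at h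
    rw [integral_add ((hint k).const_mul _) (integrable_const _), integral_const_mul] at h
    simpa using h
  have hN0' : (0 : ℝ) < N 0 := by exact_mod_cast hNpos 0
  have hNk : (N 0 : ℝ) ≤ N k := by exact_mod_cast hNmono (Nat.zero_le k)
  have hNk' : (0 : ℝ) < N k := hN0'.trans_le hNk
  have hnoise' : 1 / (2 * L) * ∫ ω, ‖w k ω‖ ^ 2 ∂P ≤
      2 * ν₁ ^ 2 / (L * τ * N 0) * D + (2 * ν₁ ^ 2 * ‖xstar‖ ^ 2 + ν₂ ^ 2) / (2 * L * N k) := by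
    calc _ ≤ 1 / (2 * L) * ((ν₁ ^ 2 * (4 / τ * D + 2 * ‖xstar‖ ^ 2) + ν₂ ^ 2) / N k) := by
          refine mul_le_mul_of_nonneg_left (hnoise.trans ?_) (by positivity)
          gcongr
      _ = 2 * ν₁ ^ 2 / (L * τ * N k) * D
          + (2 * ν₁ ^ 2 * ‖xstar‖ ^ 2 + ν₂ ^ 2) / (2 * L * N k) := by
        field_simp
        ring
      _ ≤ _ := by gcongr
  linarith
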